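/- For every k ≥ 1, every k-uniform hypergraph K on a finite vertex set V(K), and every ε > 0, there is a δ > 0 such that whenever A is a k-uniform hypergraph on a finite vertex set V(A) with hom(K,A) < δ·|V(A)|^{|V(K)|}, there is a set C ⊆ A with |C| ≤ ε·binom(|V(A)|, k) such that hom(K, A ∖ C) = 0. -/

import Mathlib

open scoped Classical

namespace HypergraphRemoval

open MeasureTheory Set Filter
open scoped symmDiff ENNReal Topology

section Abstract

variable {ι X : Type*}

/-- The σ-algebra generated by the families `𝒜 J` with `J ∈ I`. -/
abbrev joinSigma (𝒜 : Finset ι → Set (Set X)) (I : Set (Finset ι)) : MeasurableSpace X :=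
  MeasurableSpace.generateFrom {T | ∃ J ∈ I, T ∈ 𝒜 J}

lemma joinSigma_mono (𝒜 : Finset ι → Set (Set X)) {I I' : Set (Finset ι)} (h : I ⊆ I') :
    joinSigma 𝒜 I ≤ joinSigma 𝒜 I' :=
  MeasurableSpace.generateFrom_mono fun _ ⟨J, hJ, hT⟩ => ⟨J, h hJ, hT⟩

lemma measurableSet_joinSigma {𝒜 : Finset ι → Set (Set X)} {I : Set (Finset ι)} {J : Finset ι}
    {T : Set X} (hJ : J ∈ I) (hT : T ∈ 𝒜 J) : MeasurableSet[joinSigma 𝒜 I] T :=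
  MeasurableSpace.measurableSet_generateFrom ⟨J, hJ, hT⟩

/-- A monotone system of algebras of sets indexed by finite sets of coordinates, such that a set
depending on the coordinates in `f` only interacts with sets depending on coordinate sets not
containing `f` through the proper subsets of `f`. -/
structure IsCoordinateSystem [MeasurableSpace X] (μ : Measure X) (𝒜 : Finset ι → Set (Set X)) :
    Prop where
  isSetAlgebra : ∀ J, IsSetAlgebra (𝒜 J)
  mono : ∀ ⦃J J'⦄, J ⊆ J' → 𝒜 J ⊆ 𝒜 J'
  measurableSet : ∀ ⦃J T⦄, T ∈ 𝒜 J → MeasurableSet T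
  condExp_eq : ∀ (f : Finset ι) (I : Set (Finset ι)), (∀ J ∈ I, ¬ f ⊆ J) → (∀ J, J ⊂ f → J ∈ I) →
    ∀ A ∈ 𝒜 f, μ[A.indicator (1 : X → ℝ) | joinSigma 𝒜 I] =ᵐ[μ]
      μ[A.indicator (1 : X → ℝ) | joinSigma 𝒜 {J | J ⊂ f}]

lemma exists_mem_measureReal_symmDiff_lt [m0 : MeasurableSpace X] (μ : Measure X)
    [IsFiniteMeasure μ] {𝒞 : Set (Set X)} (h𝒞 : IsSetAlgebra 𝒞)
    (hle : MeasurableSpace.generateFrom 𝒞 ≤ m0) {E : Set X}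
    (hE : MeasurableSet[MeasurableSpace.generateFrom 𝒞] E) {δ : ℝ} (hδ : 0 < δ) :
    ∃ G ∈ 𝒞, μ.real (E ∆ G) < δ := by
  have hdense := @Measure.MeasureDense.of_generateFrom_isSetAlgebra_finite X
    (MeasurableSpace.generateFrom 𝒞) (μ.trim hle) 𝒞 (isFiniteMeasure_trim hle) h𝒞 rfl
  obtain ⟨G, hG, hlt⟩ := @Measure.MeasureDense.approx X (MeasurableSpace.generateFrom 𝒞)
    (μ.trim hle) 𝒞 hdense E hE (by
      rw [trim_measurableSet_eq hle hE]; exact measure_ne_top _ _) δ hδ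
  refine ⟨G, hG, ?_⟩
  have hG' : MeasurableSet[MeasurableSpace.generateFrom 𝒞] G :=
    MeasurableSpace.measurableSet_generateFrom hG
  rw [trim_measurableSet_eq hle (MeasurableSet.symmDiff hE hG')] at hlt
  rw [Measure.real]
  exact (ENNReal.lt_ofReal_iff_toReal_lt (measure_ne_top _ _)).1 hlt

/-- Density in `L¹` of the span of the indicators of the sets in an algebra, in the form of an
induction principle. -/
lemma exists_integral_abs_sub_le_of_isSetAlgebra {m m0 : MeasurableSpace X}
    {μ : Measure X} [IsFiniteMeasure μ] {𝒞 : Set (Set X)} (h𝒞 : IsSetAlgebra 𝒞)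
    (hm : m = MeasurableSpace.generateFrom 𝒞) (hle : m ≤ m0) {P : (X → ℝ) → Prop}
    (hind : ∀ (c : ℝ), ∀ G ∈ 𝒞, P (G.indicator fun _ => c)) (hadd : ∀ u v, P u → P v → P (u + v))
    {u : X → ℝ} (hu : Integrable u μ) (hum : StronglyMeasurable[m] u) {ε : ℝ} (hε : 0 < ε) :
    ∃ v, P v ∧ Integrable v μ ∧ ∫ x, |u x - v x| ∂μ ≤ ε := by
  obtain ⟨v, hv, hvP, hvm, hvi⟩ := @MemLp.induction_dense X ℝ m _ 1 (μ.trim hle) ENNReal.one_ne_top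
    (fun v => P v ∧ StronglyMeasurable[m] v ∧ Integrable v μ) (by
      intro c s hs _ η hη
      obtain ⟨r, hr, hrη⟩ : ∃ r : ℝ, 0 < r ∧ ‖c‖ₑ * ENNReal.ofReal r ≤ η := by
        rcases eq_or_ne η ⊤ with rfl | hη'
        · exact ⟨1, one_pos, le_top⟩
        · have hpos := ENNReal.toReal_pos hη hη'
          refine ⟨η.toReal / (|c| + 1), by positivity, ?_⟩
          rw [Real.enorm_eq_ofReal_abs, ← ENNReal.ofReal_mul (abs_nonneg c)]
          refine ENNReal.ofReal_le_of_le_toReal ?_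
          rw [mul_div_assoc', div_le_iff₀ (by positivity)]
          nlinarith
      obtain ⟨G, hG, hlt⟩ := exists_mem_measureReal_symmDiff_lt μ h𝒞 (hm ▸ hle) (hm ▸ hs) hr
      have hGm : MeasurableSet[m] G := hm ▸ MeasurableSpace.measurableSet_generateFrom hG
      have hGs : StronglyMeasurable[m] (G.indicator fun _ => c) :=
        stronglyMeasurable_const.indicator hGm
      refine ⟨G.indicator fun _ => c, ?_, hind c G hG, hGs,
        (integrable_const c).indicator (hle _ hGm)⟩
      rw [eLpNorm_trim hle (hGs.sub (stronglyMeasurable_const.indicator hs)),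
        eLpNorm_one_eq_lintegral_enorm]
      refine le_trans (le_of_eq ?_) (le_trans (mul_le_mul_right
        (ENNReal.le_ofReal_iff_toReal_le (measure_ne_top μ (s ∆ G)) hr.le |>.2 hlt.le) _) hrη)
      rw [← setLIntegral_const, ← lintegral_indicator ((hle _ hs).symmDiff (hle _ hGm))]
      congr 1
      ext x
      by_cases h1 : x ∈ s <;> by_cases h2 : x ∈ G <;> simp [h1, h2, mem_symmDiff])
    (fun v w hv hw => ⟨hadd v w hv.1 hw.1, hv.2.1.add hw.2.1, hv.2.2.add hw.2.2⟩)
    (fun v hv => hv.2.1.aestronglyMeasurable) u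
    (memLp_one_iff_integrable.2 (hu.trim hle hum)) (ENNReal.ofReal ε) (by simpa using hε)
  refine ⟨v, hvP, hvi, ?_⟩
  rw [eLpNorm_trim hle (hum.sub hvm), eLpNorm_one_eq_lintegral_enorm,
    ← ofReal_integral_norm_eq_lintegral_enorm (hu.sub hvi)] at hv
  exact (ENNReal.ofReal_le_ofReal_iff hε.le).1 hv

lemma setOf_mem_comp_eq_iUnion {α : Type*} (c : X → α) (S : α → Set X) :
    {x | x ∈ S (c x)} = ⋃ a, c ⁻¹' {a} ∩ S a := by
  ext x; simp

lemma integrable_indicator_one [MeasurableSpace X] {μ : Measure X} [IsFiniteMeasure μ] {E : Set X}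
    (hE : MeasurableSet E) : Integrable (E.indicator (1 : X → ℝ)) μ :=
  (integrable_const (1 : ℝ)).indicator hE

lemma setIntegral_condExp_indicator_one {m m0 : MeasurableSpace X} {μ : Measure X}
    [IsFiniteMeasure μ] (hm : m ≤ m0) {A T : Set X} (hA : MeasurableSet[m0] A) (hT : MeasurableSet[m] T) :
    ∫ x in T, (μ[A.indicator (1 : X → ℝ) | m]) x ∂μ = μ.real (A ∩ T) := by
  rw [setIntegral_condExp hm (integrable_indicator_one hA) hT, integral_indicator_one hA,
    measureReal_restrict_apply hA]

variable [m0 : MeasurableSpace X] {μ : Measure X} {𝒜 : Finset ι → Set (Set X)}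

lemma IsCoordinateSystem.joinSigma_le (h : IsCoordinateSystem μ 𝒜) (I : Set (Finset ι)) :
    joinSigma 𝒜 I ≤ m0 :=
  MeasurableSpace.generateFrom_le fun _ ⟨_, _, hT⟩ => h.measurableSet hT

lemma IsCoordinateSystem.exists_partition_approx [IsFiniteMeasure μ]
    (h : IsCoordinateSystem μ 𝒜) (f : Finset ι) (I : Set (Finset ι)) {E : Set X}
    (hE : MeasurableSet[joinSigma 𝒜 (insert f I)] E) {δ : ℝ} (hδ : 0 < δ) :
    ∃ (α : Type) (_ : Finite α) (c : X → α) (S : α → Set X), (∀ a, c ⁻¹' {a} ∈ 𝒜 f) ∧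
      (∀ a, MeasurableSet[joinSigma 𝒜 I] (S a)) ∧ μ.real (E ∆ {x | x ∈ S (c x)}) < δ := by
  set 𝒞 : Set (Set X) := {G | ∃ (α : Type) (_ : Finite α) (c : X → α) (S : α → Set X),
    (∀ a, c ⁻¹' {a} ∈ 𝒜 f) ∧ (∀ a, MeasurableSet[joinSigma 𝒜 I] (S a)) ∧
      G = {x | x ∈ S (c x)}}
  have halg : IsSetAlgebra 𝒞 := by
    refine ⟨⟨Unit, inferInstance, fun _ => (), fun _ => ∅, fun a => ?_, fun _ => ?_, by simp⟩,
      ?_, ?_⟩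
    · convert (h.isSetAlgebra f).univ_mem
      ext; simp
    · exact @MeasurableSet.empty _ (joinSigma 𝒜 I)
    · rintro _ ⟨α, hα, c, S, hc, hS, rfl⟩
      exact ⟨α, hα, c, fun a => (S a)ᶜ, hc, fun a => (hS a).compl, rfl⟩
    · rintro _ _ ⟨α, hα, c, S, hc, hS, rfl⟩ ⟨β, hβ, d, T, hd, hT, rfl⟩
      refine ⟨α × β, inferInstance, fun x => (c x, d x), fun p => S p.1 ∪ T p.2, ?_,
        fun p => (hS _).union (hT _), by ext; simp⟩
      rintro ⟨a, b⟩
      convert (h.isSetAlgebra f).inter_mem (hc a) (hd b)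
      ext; simp
  have hgen : MeasurableSpace.generateFrom 𝒞 = joinSigma 𝒜 (insert f I) := by
    apply le_antisymm
    · refine MeasurableSpace.generateFrom_le ?_
      rintro _ ⟨α, hα, c, S, hc, hS, rfl⟩
      rw [setOf_mem_comp_eq_iUnion]
      refine MeasurableSet.iUnion fun a => MeasurableSet.inter
        (measurableSet_joinSigma (mem_insert _ _) (hc a))
        (joinSigma_mono 𝒜 (subset_insert _ _) _ (hS a))
    · refine MeasurableSpace.generateFrom_mono ?_
      rintro T ⟨J, rfl | hJ, hT⟩
      · refine ⟨Prop, inferInstance, fun x => x ∈ T, fun p => {_x | p}, fun p => ?_, fun p => ?_,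
          by ext; simp⟩
        · by_cases hp : p
          · convert hT
            ext; simp [hp]
          · convert (h.isSetAlgebra _).compl_mem hT
            ext; simp [hp]
        · exact @MeasurableSet.const _ (joinSigma 𝒜 I) p
      · refine ⟨Unit, inferInstance, fun _ => (), fun _ => T, fun a => ?_,
          fun _ => measurableSet_joinSigma hJ hT, by ext; simp⟩
        convert (h.isSetAlgebra f).univ_mem
        ext; simp
  obtain ⟨G, ⟨α, hα, c, S, hc, hS, rfl⟩, hlt⟩ := exists_mem_measureReal_symmDiff_lt μ halg
    (hgen ▸ h.joinSigma_le _) (hgen ▸ hE) hδ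
  exact ⟨α, hα, c, S, hc, hS, hlt⟩

lemma integral_abs_indicator_sub [IsFiniteMeasure μ] {E G : Set X} (hE : MeasurableSet E)
    (hG : MeasurableSet G) :
    ∫ x, |(E.indicator (1 : X → ℝ) - G.indicator (1 : X → ℝ)) x| ∂μ = μ.real (E ∆ G) := by
  rw [← integral_indicator_one (hE.symmDiff hG)]
  congr 1
  ext x
  by_cases h1 : x ∈ E <;> by_cases h2 : x ∈ G <;> simp [h1, h2, mem_symmDiff]

lemma IsCoordinateSystem.condExp_eq_of_insert [IsFiniteMeasure μ]
    (h : IsCoordinateSystem μ 𝒜) {f : Finset ι} {I I' : Set (Finset ι)} (hII' : I ⊆ I')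
    (hI' : ∀ J ∈ I', ¬ f ⊆ J) (hI : ∀ J, J ⊂ f → J ∈ I) {E : Set X}
    (hE : MeasurableSet[joinSigma 𝒜 (insert f I)] E) :
    μ[E.indicator (1 : X → ℝ) | joinSigma 𝒜 I'] =ᵐ[μ]
      μ[E.indicator (1 : X → ℝ) | joinSigma 𝒜 I] := by
  have hE0 := h.joinSigma_le _ _ hE
  have hclose : ∀ δ : ℝ, 0 < δ → ∫ x, |(μ[E.indicator (1 : X → ℝ) | joinSigma 𝒜 I'] -
      μ[E.indicator (1 : X → ℝ) | joinSigma 𝒜 I]) x| ∂μ ≤ 2 * δ := by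
    intro δ hδ
    obtain ⟨α, hα, c, S, hc, hS, hlt⟩ := h.exists_partition_approx f I hE hδ
    have := Fintype.ofFinite α
    set G := {x | x ∈ S (c x)} with hG
    have hAS : ∀ a, MeasurableSet (c ⁻¹' {a}) := fun a => h.measurableSet (hc a)
    have hG0 : MeasurableSet G := by
      rw [hG, setOf_mem_comp_eq_iUnion]
      exact MeasurableSet.iUnion fun a => (hAS a).inter (h.joinSigma_le _ _ (hS a))
    have hsum : G.indicator (1 : X → ℝ) =
        ∑ a, (S a).indicator ((c ⁻¹' {a}).indicator (1 : X → ℝ)) := by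
      ext x
      simp [Finset.sum_apply, indicator_apply, hG, ← ite_and, Finset.filter_and,
        Finset.filter_eq]
      split_ifs with h1
      · rw [Finset.inter_singleton_of_mem (by simpa using h1)]; simp
      · rw [Finset.inter_singleton_of_notMem (by simpa using h1)]; simp
    have key : ∀ I'' : Set (Finset ι), I ⊆ I'' → (∀ J ∈ I'', ¬ f ⊆ J) →
        μ[G.indicator (1 : X → ℝ) | joinSigma 𝒜 I''] =ᵐ[μ]
          ∑ a, (S a).indicator (μ[(c ⁻¹' {a}).indicator (1 : X → ℝ) | joinSigma 𝒜 {J | J ⊂ f}]) := by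
      intro I'' h1 h2
      rw [hsum]
      refine (condExp_finsetSum (fun a _ => (integrable_indicator_one (hAS a)).indicator
        (h.joinSigma_le _ _ (hS a))) _).trans ?_
      refine eventuallyEq_sum fun a _ => ?_
      refine (condExp_indicator (integrable_indicator_one (hAS a))
        (joinSigma_mono 𝒜 h1 _ (hS a))).trans ?_
      have := h.condExp_eq f I'' h2 (fun J hJ => h1 (hI J hJ)) _ (hc a)
      filter_upwards [this] with x hx
      by_cases hxS : x ∈ S a <;> simp [hxS, hx]
    have hGeq := (key I' hII' hI').trans (key I subset_rfl fun J hJ => hI' J (hII' hJ)).symm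
    have hiE := integrable_indicator_one (μ := μ) hE0
    have hiG := integrable_indicator_one (μ := μ) hG0
    have hb : ∀ I'' : Set (Finset ι), ∫ x, |(μ[E.indicator (1 : X → ℝ) | joinSigma 𝒜 I''] -
        μ[G.indicator (1 : X → ℝ) | joinSigma 𝒜 I'']) x| ∂μ ≤ δ := by
      intro I''
      calc _ = ∫ x, |(μ[E.indicator (1 : X → ℝ) - G.indicator (1 : X → ℝ) | joinSigma 𝒜 I'']) x|
            ∂μ := by
            refine integral_congr_ae ?_
            filter_upwards [condExp_sub hiE hiG (joinSigma 𝒜 I'')] with x hx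
            rw [hx]
        _ ≤ _ := integral_abs_condExp_le _
        _ = μ.real (E ∆ G) := integral_abs_indicator_sub hE0 hG0
        _ ≤ δ := hlt.le
    calc _ ≤ ∫ x, (|(μ[E.indicator (1 : X → ℝ) | joinSigma 𝒜 I'] -
        μ[G.indicator (1 : X → ℝ) | joinSigma 𝒜 I']) x| + |(μ[E.indicator (1 : X → ℝ) | joinSigma 𝒜 I] -
        μ[G.indicator (1 : X → ℝ) | joinSigma 𝒜 I]) x|) ∂μ := by
          refine integral_mono_ae (integrable_condExp.sub integrable_condExp).abs
            ((integrable_condExp.sub integrable_condExp).abs.add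
              (integrable_condExp.sub integrable_condExp).abs) ?_
          filter_upwards [hGeq] with x hx
          simp only [Pi.sub_apply, hx]
          rw [abs_sub_comm (μ[E.indicator (1 : X → ℝ) | joinSigma 𝒜 I] x)]
          exact abs_sub_le _ _ _
      _ ≤ 2 * δ := by
          rw [integral_add (integrable_condExp.sub integrable_condExp).abs
            (integrable_condExp.sub integrable_condExp).abs]
          linarith [hb I, hb I']
  have hzero : ∫ x, |(μ[E.indicator (1 : X → ℝ) | joinSigma 𝒜 I'] -
      μ[E.indicator (1 : X → ℝ) | joinSigma 𝒜 I]) x| ∂μ = 0 := by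
    refine le_antisymm (le_of_forall_pos_le_add fun ε hε => ?_)
      (integral_nonneg fun x => abs_nonneg _)
    linarith [hclose (ε / 2) (by positivity)]
  rw [integral_eq_zero_iff_of_nonneg (fun x => abs_nonneg _)
    (integrable_condExp.sub integrable_condExp).abs] at hzero
  filter_upwards [hzero] with x hx
  simpa [sub_eq_zero] using hx

/-- The points at which the conditional probability of `A \ E` given `joinSigma 𝒜 I` is less than
`1 / N` of the conditional probability of `A` given the sets on proper subsets of `f`. -/
def goodPart (μ : Measure X) (𝒜 : Finset ι → Set (Set X)) (f : Finset ι) (I : Set (Finset ι))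
    (N : ℕ) (A E : Set X) : Set X :=
  {x | N * (μ[(A \ E).indicator (1 : X → ℝ) | joinSigma 𝒜 I]) x <
    (μ[A.indicator (1 : X → ℝ) | joinSigma 𝒜 {J | J ⊂ f}]) x}

lemma measurableSet_goodPart {f : Finset ι} {I : Set (Finset ι)} (hI : ∀ J, J ⊂ f → J ∈ I)
    (N : ℕ) (A E : Set X) : MeasurableSet[joinSigma 𝒜 I] (goodPart μ 𝒜 f I N A E) :=
  @measurableSet_lt _ _ _ _ _ (joinSigma 𝒜 I) _ _ _ _ _
    ((stronglyMeasurable_condExp.measurable).const_mul _)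
    (stronglyMeasurable_condExp.measurable.mono (joinSigma_mono 𝒜 hI) le_rfl)

lemma IsCoordinateSystem.measure_iInter_goodPart_eq_zero [IsFiniteMeasure μ]
    (h : IsCoordinateSystem μ 𝒜) {κ : Type*} [Fintype κ] {f : Finset ι} {I : κ → Set (Finset ι)}
    {I₀ : Set (Finset ι)} (hI₀ : ∀ J ∈ I₀, ¬ f ⊆ J) (hf : ∀ J, J ⊂ f → J ∈ I₀)
    (hsub : ∀ i, I i ⊆ I₀) {s : Finset κ} (hs : s.Nonempty) (hI : ∀ i ∈ s, ∀ J, J ⊂ f → J ∈ I i)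
    {E D : κ → Set X} {A : Set X} (hA : A ∈ 𝒜 f)
    (hE : ∀ i ∈ s, MeasurableSet[joinSigma 𝒜 (insert f (I i))] (E i))
    (hDm : ∀ i, MeasurableSet[joinSigma 𝒜 I₀] (D i))
    (hD : ∀ i ∈ s, D i = goodPart μ 𝒜 f (I i) s.card A (E i))
    (hD' : ∀ i ∉ s, D i ⊆ E i) (h0 : μ (⋂ i, E i) = 0) : μ (⋂ i, D i) = 0 := by
  set p := μ[A.indicator (1 : X → ℝ) | joinSigma 𝒜 {J | J ⊂ f}]
  set q := fun i => μ[(A \ E i).indicator (1 : X → ℝ) | joinSigma 𝒜 (I i)]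
  set T := ⋂ i, D i
  have hTm : MeasurableSet[joinSigma 𝒜 I₀] T := MeasurableSet.iInter hDm
  have hT0 : MeasurableSet T := h.joinSigma_le _ _ hTm
  have hA0 := h.measurableSet hA
  have hAE : ∀ i ∈ s, MeasurableSet[joinSigma 𝒜 (insert f (I i))] (A \ E i) := fun i hi =>
    (measurableSet_joinSigma (mem_insert _ _) hA).diff (hE i hi)
  have hpT : ∫ x in T, p x ∂μ = μ.real (A ∩ T) := by
    rw [← setIntegral_condExp_indicator_one (h.joinSigma_le I₀) hA0 hTm]
    exact integral_congr_ae (ae_restrict_of_ae (h.condExp_eq f I₀ hI₀ hf A hA).symm)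
  have hqT : ∀ i ∈ s, ∫ x in T, q i x ∂μ = μ.real ((A \ E i) ∩ T) := by
    intro i hi
    rw [← setIntegral_condExp_indicator_one (h.joinSigma_le I₀)
      (h.joinSigma_le _ _ (hAE i hi)) hTm]
    exact integral_congr_ae (ae_restrict_of_ae
      (h.condExp_eq_of_insert (hsub i) hI₀ (hI i hi) (hAE i hi)).symm)
  have hpos : ∀ x ∈ T, 0 < p x - ∑ i ∈ s, q i x := by
    intro x hx
    have hlt : ∀ i ∈ s, s.card * q i x < p x := by
      intro i hi
      have := mem_iInter.1 hx i
      rw [hD i hi] at this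
      exact this
    have hc : (0 : ℝ) < s.card := by exact_mod_cast hs.card_pos
    have := Finset.sum_lt_sum_of_nonempty hs hlt
    rw [← Finset.mul_sum, Finset.sum_const, nsmul_eq_mul] at this
    have := lt_of_mul_lt_mul_left this hc.le
    linarith
  have hint : ∫ x in T, (p x - ∑ i ∈ s, q i x) ∂μ ≤ 0 := by
    have hpi : Integrable p (μ.restrict T) := integrable_condExp.restrict
    have hqi : ∀ i ∈ s, Integrable (q i) (μ.restrict T) := fun i _ => integrable_condExp.restrict
    rw [integral_sub hpi (integrable_finsetSum _ hqi), integral_finsetSum _ hqi, hpT,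
      Finset.sum_congr rfl hqT]
    have hcover : A ∩ T ⊆ (⋂ i, E i) ∪ ⋃ i ∈ s, (A \ E i) ∩ T := by
      intro x ⟨hxA, hxT⟩
      by_cases hx : ∀ i, x ∈ E i
      · exact Or.inl (mem_iInter.2 hx)
      · push Not at hx
        obtain ⟨i, hi⟩ := hx
        have his : i ∈ s := by
          by_contra hc
          exact hi (hD' i hc (mem_iInter.1 hxT i))
        exact Or.inr (mem_iUnion₂.2 ⟨i, his, ⟨hxA, hi⟩, hxT⟩)
    have h1 : μ.real (A ∩ T) ≤ μ.real (⋂ i, E i) + μ.real (⋃ i ∈ s, (A \ E i) ∩ T) :=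
      (measureReal_mono hcover).trans (measureReal_union_le _ _)
    have h2 := measureReal_biUnion_finset_le (μ := μ) s fun i => (A \ E i) ∩ T
    have h3 : μ.real (⋂ i, E i) = 0 := by simp [Measure.real, h0]
    linarith
  by_contra hT
  have hsupp : T ⊆ Function.support fun x => p x - ∑ i ∈ s, q i x := fun x hx => (hpos x hx).ne'
  have hlt := (setIntegral_pos_iff_support_of_nonneg_ae (μ := μ) (s := T)
    (f := fun x => p x - ∑ i ∈ s, q i x)
    ((ae_restrict_mem hT0).mono fun x hx => (hpos x hx).le)
    (integrable_condExp.sub (integrable_finsetSum _ fun i _ => integrable_condExp)).integrableOn).2 (by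
      rw [inter_eq_self_of_subset_right hsupp]
      exact pos_iff_ne_zero.2 hT)
  linarith

lemma IsCoordinateSystem.measureReal_diff_goodPart_le [IsFiniteMeasure μ]
    (h : IsCoordinateSystem μ 𝒜) {f : Finset ι} {I : Set (Finset ι)} (hIf : ∀ J ∈ I, ¬ f ⊆ J)
    (hI : ∀ J, J ⊂ f → J ∈ I) (N : ℕ) {A E S : Set X} (hA : A ∈ 𝒜 f) (hE : MeasurableSet E)
    (hS : MeasurableSet[joinSigma 𝒜 I] S) :
    μ.real (A ∩ (S \ goodPart μ 𝒜 f I N A E)) ≤ N * μ.real ((A \ E) ∩ S) := by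
  set D := goodPart μ 𝒜 f I N A E
  have hSD : MeasurableSet[joinSigma 𝒜 I] (S \ D) := hS.diff (measurableSet_goodPart hI N A E)
  have hA0 := h.measurableSet hA
  calc μ.real (A ∩ (S \ D))
      = ∫ x in S \ D, (μ[A.indicator (1 : X → ℝ) | joinSigma 𝒜 {J | J ⊂ f}]) x ∂μ := by
        rw [← setIntegral_condExp_indicator_one (h.joinSigma_le I) hA0 hSD]
        exact integral_congr_ae (ae_restrict_of_ae (h.condExp_eq f I hIf hI A hA))
    _ ≤ ∫ x in S \ D, N * (μ[(A \ E).indicator (1 : X → ℝ) | joinSigma 𝒜 I]) x ∂μ := by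
        refine setIntegral_mono_on integrable_condExp.integrableOn
          (integrable_condExp.const_mul _).integrableOn (h.joinSigma_le _ _ hSD) fun x hx => ?_
        exact not_lt.1 hx.2
    _ = N * μ.real ((A \ E) ∩ (S \ D)) := by
        rw [integral_const_mul, setIntegral_condExp_indicator_one (h.joinSigma_le I)
          (hA0.diff hE) hSD]
    _ ≤ N * μ.real ((A \ E) ∩ S) := 
        mul_le_mul_of_nonneg_left (measureReal_mono (inter_subset_inter_right _ sdiff_subset))
          (by positivity)

lemma sum_measureReal_preimage_inter [IsFiniteMeasure μ] {α : Type*} [Fintype α] {c : X → α}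
    (hc : ∀ a, MeasurableSet (c ⁻¹' {a})) (T : Set X) :
    ∑ a, μ.real (c ⁻¹' {a} ∩ T) = μ.real T := by
  have := sum_measureReal_preimage_singleton (μ := μ.restrict T) Finset.univ (f := c)
    (fun a _ => hc a)
  simpa [measureReal_restrict_apply (hc _)] using this

lemma IsCoordinateSystem.measureReal_diff_partition_goodPart_le [IsFiniteMeasure μ]
    (h : IsCoordinateSystem μ 𝒜) {f : Finset ι} {I : Set (Finset ι)} (hIf : ∀ J ∈ I, ¬ f ⊆ J)
    (hI : ∀ J, J ⊂ f → J ∈ I) (N : ℕ) {E : Set X} (hE : MeasurableSet E)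
    {α : Type*} [Finite α] {c : X → α} (hc : ∀ a, c ⁻¹' {a} ∈ 𝒜 f) {S : α → Set X}
    (hS : ∀ a, MeasurableSet[joinSigma 𝒜 I] (S a)) {δ : ℝ}
    (hδ : μ.real (E ∆ {x | x ∈ S (c x)}) ≤ δ) :
    μ.real (E \ {x | x ∈ goodPart μ 𝒜 f I N (c ⁻¹' {c x}) E}) ≤ (1 + N) * δ := by
  have := Fintype.ofFinite α
  set G := {x | x ∈ S (c x)}
  set D := {x | x ∈ goodPart μ 𝒜 f I N (c ⁻¹' {c x}) E}
  have hcm : ∀ a, MeasurableSet (c ⁻¹' {a}) := fun a => h.measurableSet (hc a)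
  have h1 : μ.real (E \ D) ≤ μ.real (E \ G) + μ.real (G \ D) := by
    refine (measureReal_mono fun x hx => ?_).trans (measureReal_union_le _ _)
    by_cases hxG : x ∈ G
    · exact Or.inr ⟨hxG, hx.2⟩
    · exact Or.inl ⟨hx.1, hxG⟩
  have h2 : μ.real (G \ D) ≤ N * μ.real (G \ E) := by
    rw [← sum_measureReal_preimage_inter hcm (G \ D), ← sum_measureReal_preimage_inter hcm (G \ E),
      Finset.mul_sum]
    refine Finset.sum_le_sum fun a _ => ?_
    have hGD : c ⁻¹' {a} ∩ (G \ D) = c ⁻¹' {a} ∩ (S a \ goodPart μ 𝒜 f I N (c ⁻¹' {a}) E) := by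
      ext x
      constructor <;> (rintro ⟨rfl, h⟩; exact ⟨rfl, h⟩)
    have hGE : c ⁻¹' {a} ∩ (G \ E) = (c ⁻¹' {a} \ E) ∩ S a := by
      ext x
      constructor
      · rintro ⟨rfl, h, h'⟩; exact ⟨⟨rfl, h'⟩, h⟩
      · rintro ⟨⟨rfl, h⟩, h'⟩; exact ⟨rfl, h', h⟩
    rw [hGD, hGE]
    exact h.measureReal_diff_goodPart_le hIf hI N (hc a) hE (hS a)
  have h3 : μ.real (E \ G) ≤ δ := (measureReal_mono fun x hx => Or.inl hx).trans hδ
  have h4 : μ.real (G \ E) ≤ δ := (measureReal_mono fun x hx => Or.inr hx).trans hδ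
  have h5 : N * μ.real (G \ E) ≤ N * δ := by gcongr
  linarith

lemma measureReal_iUnion_lt [IsFiniteMeasure μ] {α : Type*} [Fintype α] {T : α → Set X} {ε : ℝ}
    (hε : 0 < ε) (hT : ∀ a, μ.real (T a) < ε / (Fintype.card α + 1)) : μ.real (⋃ a, T a) < ε := by
  have hpos : (0 : ℝ) < Fintype.card α + 1 := by positivity
  calc μ.real (⋃ a, T a) ≤ ∑ a, μ.real (T a) := measureReal_iUnion_fintype_le _
    _ ≤ ∑ _a : α, ε / (Fintype.card α + 1) := Finset.sum_le_sum fun a _ => (hT a).le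
    _ = Fintype.card α * ε / (Fintype.card α + 1) := by
      rw [Finset.sum_const, Finset.card_univ, nsmul_eq_mul, mul_div_assoc]
    _ < ε := by
      rw [div_lt_iff₀ hpos]
      nlinarith

/-- Sets with null intersection, each measurable with respect to a join over a lower set of
coordinate sets, can be shrunk slightly to sets in the algebras with empty intersection. -/
lemma IsCoordinateSystem.exists_iInter_eq_empty_of_subset [IsProbabilityMeasure μ]
    (h : IsCoordinateSystem μ 𝒜) {κ : Type*} [Fintype κ] (e : κ → Finset ι)
    (𝓘 : Finset (Finset ι)) (I : κ → Set (Finset ι)) (hI𝓘 : ∀ i, I i ⊆ 𝓘)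
    (hI : ∀ i, IsLowerSet (I i)) (hIe : ∀ i, ∀ J ∈ I i, J ⊆ e i) (E : κ → Set X)
    (hE : ∀ i, MeasurableSet[joinSigma 𝒜 (I i)] (E i)) (h0 : μ (⋂ i, E i) = 0) {ε : ℝ}
    (hε : 0 < ε) :
    ∃ F : κ → Set X, (∀ i, F i ∈ 𝒜 (e i)) ∧ (∀ i, μ.real (E i \ F i) < ε) ∧ ⋂ i, F i = ∅ := by
  induction hn : 𝓘.card generalizing 𝓘 I E ε with
  | zero =>
    rw [Finset.card_eq_zero] at hn
    have htriv : ∀ i, E i = ∅ ∨ E i = univ := by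
      intro i
      have hIi : I i = ∅ := subset_empty_iff.1 (by simpa [hn] using hI𝓘 i)
      have hbot : joinSigma 𝒜 (I i) = ⊥ := by
        rw [joinSigma, ← MeasurableSpace.generateFrom_empty]
        congr 1
        ext
        simp [hIi]
      have := hE i
      rwa [hbot, MeasurableSpace.measurableSet_bot_iff] at this
    refine ⟨E, fun i => ?_, fun i => by simpa using hε, ?_⟩
    · rcases htriv i with hi | hi
      · exact hi ▸ (h.isSetAlgebra _).empty_mem
      · exact hi ▸ (h.isSetAlgebra _).univ_mem
    · by_contra hne
      obtain ⟨x, hx⟩ := nonempty_iff_ne_empty.2 hne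
      have huniv : ⋂ i, E i = univ := by
        refine iInter_eq_univ.2 fun i => (htriv i).resolve_left fun hi => ?_
        have := mem_iInter.1 hx i
        rw [hi] at this
        exact this
      rw [huniv] at h0
      simp at h0
  | succ n ih =>
    obtain ⟨f, hf⟩ := Finset.exists_maximal (s := 𝓘) (Finset.card_pos.1 (by lia))
    have hfmax : ∀ J ∈ 𝓘.erase f, ¬ f ⊆ J := fun J hJ hfJ =>
      (Finset.mem_erase.1 hJ).1 (le_antisymm (hf.2 (Finset.mem_of_mem_erase hJ) hfJ) hfJ)
    have hcard : (𝓘.erase f).card = n := by rw [Finset.card_erase_of_mem hf.1, hn]; simp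
    have hsub : ∀ i, I i \ {f} ⊆ (𝓘.erase f : Finset (Finset ι)) := fun i J hJ =>
      Finset.mem_coe.2 (Finset.mem_erase.2 ⟨hJ.2, hI𝓘 i hJ.1⟩)
    have hlow : ∀ i, IsLowerSet (I i \ {f}) := by
      refine fun i J J' hJJ hJ => ⟨hI i hJJ hJ.1, ?_⟩
      rintro rfl
      exact hfmax J (hsub i hJ) hJJ
    have hins : ∀ i, f ∈ I i → insert f (I i \ {f}) = I i := fun i hi => by simp [hi]
    have hsing : ∀ i, f ∉ I i → I i \ {f} = I i := fun i hi => sdiff_singleton_eq_self hi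
    set s : Finset κ := Finset.univ.filter fun i => f ∈ I i with hs
    have hmem : ∀ i, i ∈ s ↔ f ∈ I i := fun i => by simp [hs]
    rcases s.eq_empty_or_nonempty with hemp | hne
    · have hnot : ∀ i, f ∉ I i := fun i hi => by simpa [hemp] using (hmem i).2 hi
      exact ih (𝓘.erase f) I (fun i => by rw [← hsing i (hnot i)]; exact hsub i) hI hIe E hE h0 hε
        hcard
    have hssub : ∀ i, f ∈ I i → ∀ J, J ⊂ f → J ∈ I i \ {f} := fun i hi J hJ =>
      ⟨hI i hJ.1 hi, hJ.ne⟩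
    have happ : ∀ i, ∃ (α : Type) (_ : Finite α) (c : X → α) (S : α → Set X),
        (∀ a, c ⁻¹' {a} ∈ 𝒜 f) ∧ (∀ a, MeasurableSet[joinSigma 𝒜 (I i \ {f})] (S a)) ∧
          (f ∈ I i → μ.real (E i ∆ {x | x ∈ S (c x)}) < ε / (2 * (1 + s.card))) := by
      intro i
      by_cases hi : f ∈ I i
      · obtain ⟨α, hα, c, S, hc, hS, hlt⟩ := h.exists_partition_approx f (I i \ {f}) (E := E i)
          (by rw [hins i hi]; exact hE i) (δ := ε / (2 * (1 + s.card))) (by positivity)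
        exact ⟨α, hα, c, S, hc, hS, fun _ => hlt⟩
      · obtain ⟨α, hα, c, S, hc, hS, -⟩ := h.exists_partition_approx f (I i \ {f}) (E := ∅)
          (@MeasurableSet.empty _ (joinSigma 𝒜 _)) one_pos
        exact ⟨α, hα, c, S, hc, hS, fun hi' => absurd hi' hi⟩
    choose α hα c S hc hS hlt using happ
    have := fun i => Fintype.ofFinite (α i)
    set cc : X → ∀ i, α i := fun x i => c i x with hcc
    have hccm : ∀ a, cc ⁻¹' {a} ∈ 𝒜 f := by
      intro a
      have : cc ⁻¹' {a} = ⋂ i ∈ Finset.univ, c i ⁻¹' {a i} := by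
        ext x
        simp [hcc, funext_iff]
      rw [this]
      exact (h.isSetAlgebra f).biInter_mem _ fun i _ => hc i _
    set D : (∀ i, α i) → κ → Set X := fun a i =>
      if f ∈ I i then goodPart μ 𝒜 f (I i \ {f}) s.card (cc ⁻¹' {a}) (E i) else E i with hD
    have hDm : ∀ a i, MeasurableSet[joinSigma 𝒜 (I i \ {f})] (D a i) := by
      intro a i
      by_cases hi : f ∈ I i
      · simp only [hD, hi, if_true]
        exact measurableSet_goodPart (hssub i hi) _ _ _
      · simp only [hD, hi, if_false]
        rw [hsing i hi]
        exact hE i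
    have hD0 : ∀ a, μ (⋂ i, D a i) = 0 := by
      intro a
      obtain ⟨i₀, hi₀⟩ := hne
      refine h.measure_iInter_goodPart_eq_zero (I := fun i => I i \ {f}) (I₀ := 𝓘.erase f) hfmax
        (fun J hJ => hsub i₀ (hssub i₀ ((hmem _).1 hi₀) J hJ)) hsub ⟨i₀, hi₀⟩
        (fun i hi => hssub i ((hmem i).1 hi)) (hccm a) (fun i hi => ?_)
        (fun i => joinSigma_mono 𝒜 (hsub i) _ (hDm a i)) (fun i hi => ?_) (fun i hi => ?_) h0
      · rw [hins i ((hmem i).1 hi)]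
        exact hE i
      · simp only [hD, (hmem i).1 hi, if_true]
      · simp only [hD, mt (hmem i).2 hi, if_false, subset_rfl]
    have hD' := fun a => ih (𝓘.erase f) (fun i => I i \ {f}) hsub hlow (fun i J hJ => hIe i J hJ.1)
      (D a) (hDm a) (hD0 a) (ε := ε / 2 / (Fintype.card (∀ i, α i) + 1)) (by positivity) hcard
    choose D' hD'm hD'lt hD'emp using hD'
    have hloss : ∀ i, μ.real (⋃ a, D a i \ D' a i) < ε / 2 := fun i =>
      measureReal_iUnion_lt (by positivity) fun a => hD'lt a i
    refine ⟨fun i => if f ∈ I i then {x | x ∈ D' (cc x) i} else ⋂ a, D' a i, fun i => ?_,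
      fun i => ?_, ?_⟩
    · by_cases hi : f ∈ I i
      · simp only [hi, if_true, setOf_mem_comp_eq_iUnion cc fun a => D' a i]
        have := (h.isSetAlgebra (e i)).isSetRing.biUnion_mem (ι := ∀ i, α i)
          (s := fun a => cc ⁻¹' {a} ∩ D' a i) Finset.univ
          fun a _ => (h.isSetAlgebra _).inter_mem (h.mono (hIe i f hi) (hccm a)) (hD'm a i)
        simpa using this
      · simp only [hi, if_false]
        have := (h.isSetAlgebra (e i)).biInter_mem (ι := ∀ i, α i) (s := fun a => D' a i)
          Finset.univ fun a _ => hD'm a i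
        simpa using this
    · by_cases hi : f ∈ I i
      · simp only [hi, if_true]
        have h1 := h.measureReal_diff_partition_goodPart_le
          (fun J hJ => hfmax J (hsub i hJ)) (hssub i hi) s.card (h.joinSigma_le _ _ (hE i)) hccm
          (S := fun a => S i (a i)) (fun a => hS i (a i)) (hlt i hi).le
        have h2 : (1 + s.card) * (ε / (2 * (1 + s.card))) = ε / 2 := by field_simp
        rw [h2] at h1
        have h3 : E i \ {x | x ∈ D' (cc x) i} ⊆
            (E i \ {x | x ∈ goodPart μ 𝒜 f (I i \ {f}) s.card (cc ⁻¹' {cc x}) (E i)}) ∪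
              ⋃ a, D a i \ D' a i := by
          intro x hx
          by_cases hxg : x ∈ goodPart μ 𝒜 f (I i \ {f}) s.card (cc ⁻¹' {cc x}) (E i)
          · refine Or.inr (mem_iUnion.2 ⟨cc x, ?_, hx.2⟩)
            simp only [hD, hi, if_true, hxg]
          · exact Or.inl ⟨hx.1, hxg⟩
        have := (measureReal_mono (μ := μ) h3).trans (measureReal_union_le _ _)
        linarith [hloss i]
      · simp only [hi, if_false]
        refine (measureReal_mono (μ := μ) ?_).trans_lt ((hloss i).trans (by linarith))
        intro x hx
        obtain ⟨a, ha⟩ := not_forall.1 (mt mem_iInter.2 hx.2)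
        refine mem_iUnion.2 ⟨a, ?_, ha⟩
        simp only [hD, hi, if_false, hx.1]
    · refine eq_empty_of_forall_notMem fun x hx => ?_
      have : x ∈ ⋂ i, D' (cc x) i := by
        refine mem_iInter.2 fun i => ?_
        have hxi := mem_iInter.1 hx i
        by_cases hi : f ∈ I i
        · simp only [hi, if_true] at hxi
          exact hxi
        · simp only [hi, if_false] at hxi
          exact mem_iInter.1 hxi _
      rw [hD'emp] at this
      exact this

lemma IsCoordinateSystem.exists_iInter_eq_empty [IsProbabilityMeasure μ]
    (h : IsCoordinateSystem μ 𝒜) {κ : Type*} [Fintype κ] (e : κ → Finset ι) (E : κ → Set X)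
    (hE : ∀ i, E i ∈ 𝒜 (e i)) (h0 : μ (⋂ i, E i) = 0) {ε : ℝ} (hε : 0 < ε) :
    ∃ F : κ → Set X, (∀ i, F i ∈ 𝒜 (e i)) ∧ (∀ i, μ.real (E i \ F i) < ε) ∧ ⋂ i, F i = ∅ :=
  h.exists_iInter_eq_empty_of_subset e (Finset.univ.biUnion fun i => (e i).powerset)
    (fun i => {J | J ⊆ e i})
    (fun i J hJ => by
      simp only [Finset.coe_biUnion, mem_iUnion]
      exact ⟨i, Finset.mem_coe.2 (Finset.mem_univ i), Finset.mem_coe.2 (Finset.mem_powerset.2 hJ)⟩)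
    (fun i J J' hJJ hJ => hJJ.trans hJ) (fun i J hJ => hJ) E
    (fun i => measurableSet_joinSigma (J := e i) (show e i ⊆ e i from subset_rfl) (hE i)) h0 hε

end Abstract

section Loeb

/-- The product of a sequence of types, regarded as the space of representatives of their
ultraproduct. -/
def UProd (Y : ℕ → Type*) := ∀ n, Y n

variable {Y : ℕ → Type*}

/-- The internal set represented by the sequence `S`. -/
def internal (S : ∀ n, Set (Y n)) : Set (UProd Y) :=
  {x | ∀ᶠ n in (hyperfilter ℕ : Filter ℕ), x n ∈ S n}

lemma mem_internal {S : ∀ n, Set (Y n)} {x : UProd Y} :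
    x ∈ internal S ↔ ∀ᶠ n in (hyperfilter ℕ : Filter ℕ), x n ∈ S n := Iff.rfl

lemma internal_compl (S : ∀ n, Set (Y n)) : internal (fun n => (S n)ᶜ) = (internal S)ᶜ := by
  ext x
  exact Ultrafilter.eventually_not

lemma internal_union (S T : ∀ n, Set (Y n)) :
    internal (fun n => S n ∪ T n) = internal S ∪ internal T := by
  ext x
  exact Ultrafilter.eventually_or

lemma internal_inter (S T : ∀ n, Set (Y n)) :
    internal (fun n => S n ∩ T n) = internal S ∩ internal T := by
  ext x
  exact eventually_and

lemma internal_sdiff (S T : ∀ n, Set (Y n)) :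
    internal (fun n => S n \ T n) = internal S \ internal T := by
  simp only [sdiff_eq, internal_inter, internal_compl]

lemma internal_iInter {κ : Type*} [Finite κ] (S : κ → ∀ n, Set (Y n)) :
    internal (fun n => ⋂ i, S i n) = ⋂ i, internal (S i) := by
  ext x
  simp only [mem_internal, mem_iInter, eventually_all]

lemma internal_empty : internal (fun n => (∅ : Set (Y n))) = ∅ := by
  ext x
  simp [mem_internal, (hyperfilter ℕ).neBot'.ne]

/-- The proportion of the elements of a finite type lying in `S`. -/
noncomputable def density {α : Type*} (S : Set α) : ℝ≥0∞ := S.ncard / Nat.card α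

/-- The ultralimit of the densities of a sequence of sets. -/
noncomputable def ultraDensity (S : ∀ n, Set (Y n)) : ℝ≥0∞ :=
  ((hyperfilter ℕ).map fun n => density (S n)).lim

lemma tendsto_ultraDensity (S : ∀ n, Set (Y n)) :
    Tendsto (fun n => density (S n)) (hyperfilter ℕ : Filter ℕ) (𝓝 (ultraDensity S)) :=
  Ultrafilter.le_nhds_lim _

lemma isSetAlgebra_range_internal : IsSetAlgebra (range (internal (Y := Y))) where
  empty_mem := ⟨_, internal_empty⟩
  compl_mem := by
    rintro _ ⟨S, rfl⟩
    exact ⟨_, internal_compl S⟩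
  union_mem := by
    rintro _ _ ⟨S, rfl⟩ ⟨T, rfl⟩
    exact ⟨_, internal_union S T⟩

instance : MeasurableSpace (UProd Y) := MeasurableSpace.generateFrom (range internal)

lemma measurableSet_internal (S : ∀ n, Set (Y n)) : MeasurableSet (internal S) :=
  MeasurableSpace.measurableSet_generateFrom ⟨S, rfl⟩

variable [∀ n, Nonempty (Y n)]

lemma internal_subset_iff {S T : ∀ n, Set (Y n)} :
    internal S ⊆ internal T ↔ ∀ᶠ n in (hyperfilter ℕ : Filter ℕ), S n ⊆ T n := by
  refine ⟨fun h => ?_, fun h x hx => by filter_upwards [h, hx] with n h1 h2 using h1 h2⟩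
  by_contra hc
  rw [← Ultrafilter.eventually_not] at hc
  have hx : ∀ n, ∃ y : Y n, ¬ S n ⊆ T n → y ∈ S n ∧ y ∉ T n := by
    intro n
    by_cases hn : S n ⊆ T n
    · exact ⟨Classical.arbitrary _, fun h => absurd hn h⟩
    · obtain ⟨y, hy⟩ := not_subset.1 hn
      exact ⟨y, fun _ => hy⟩
  choose x hx using hx
  have h1 : (x : UProd Y) ∈ internal S := by filter_upwards [hc] with n hn using (hx n hn).1
  obtain ⟨n, hn, hn'⟩ := (hc.and (h h1)).exists
  exact (hx n hn).2 hn'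

lemma internal_eq_empty_iff {S : ∀ n, Set (Y n)} :
    internal S = ∅ ↔ ∀ᶠ n in (hyperfilter ℕ : Filter ℕ), S n = ∅ := by
  simp only [← subset_empty_iff]
  rw [← internal_empty, internal_subset_iff]

/-- Countable saturation of ultraproducts. -/
lemma exists_internal_subset_biUnion {T : ∀ n, Set (Y n)} {S : ℕ → ∀ n, Set (Y n)}
    (h : internal T ⊆ ⋃ k, internal (S k)) :
    ∃ N, internal T ⊆ ⋃ k ∈ Finset.range N, internal (S k) := by
  by_contra! hc
  set P : ℕ → ℕ → Prop := fun n N => ∃ y ∈ T n, ∀ k < N, y ∉ S k n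
  have hev : ∀ N, ∀ᶠ n in (hyperfilter ℕ : Filter ℕ), P n N := by
    intro N
    obtain ⟨x, hxT, hxS⟩ := not_subset.1 (hc N)
    have hall : ∀ k ∈ Finset.range N, ∀ᶠ n in (hyperfilter ℕ : Filter ℕ), x n ∉ S k n :=
      fun k hk => Ultrafilter.eventually_not.2 fun hk' => hxS (mem_iUnion₂.2 ⟨k, hk, hk'⟩)
    filter_upwards [hxT, (eventually_all_finset _).2 hall] with n h1 h2
    exact ⟨x n, h1, fun k hk => h2 k (Finset.mem_range.2 hk)⟩
  have hx : ∀ n, ∃ y : Y n, P n 0 →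
      y ∈ T n ∧ ∀ k < Nat.findGreatest (P n) n, y ∉ S k n := by
    intro n
    by_cases h0 : P n 0
    · obtain ⟨y, hy⟩ := Nat.findGreatest_spec (Nat.zero_le n) h0
      exact ⟨y, fun _ => hy⟩
    · exact ⟨Classical.arbitrary _, fun h => absurd h h0⟩
  choose x hx using hx
  have hxT : (x : UProd Y) ∈ internal T := by
    filter_upwards [hev 0] with n hn using (hx n hn).1
  obtain ⟨k, hk⟩ := mem_iUnion.1 (h hxT)
  have hlarge : ∀ᶠ n in (hyperfilter ℕ : Filter ℕ), k + 1 ≤ n :=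
    (Nat.hyperfilter_le_atTop) (eventually_ge_atTop (k + 1))
  obtain ⟨n, h1, h2, h3, h4⟩ := ((hev 0).and ((hev (k + 1)).and (hlarge.and hk))).exists
  exact (hx n h1).2 k (Nat.le_findGreatest h3 h2) h4

lemma ultraDensity_congr {S T : ∀ n, Set (Y n)} (h : internal S = internal T) :
    ultraDensity S = ultraDensity T := by
  refine tendsto_nhds_unique (tendsto_ultraDensity S) ((tendsto_ultraDensity T).congr' ?_)
  filter_upwards [internal_subset_iff.1 h.subset, internal_subset_iff.1 h.symm.subset] with n h1 h2
  rw [h1.antisymm h2]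

variable [∀ n, Fintype (Y n)]

/-- The finitely additive measure on internal sets given by ultralimits of densities. -/
noncomputable def internalContent (Y : ℕ → Type*) [∀ n, Nonempty (Y n)] [∀ n, Fintype (Y n)] :
    AddContent ℝ≥0∞ (range (internal (Y := Y))) :=
  isSetAlgebra_range_internal.isSetRing.addContent_of_union
    (fun T => if h : ∃ S, internal S = T then ultraDensity h.choose else 0)
    (by
      have h : ∃ S, internal S = (∅ : Set (UProd Y)) := ⟨_, internal_empty⟩
      rw [dif_pos h, ultraDensity_congr (h.choose_spec.trans internal_empty.symm)]
      refine tendsto_nhds_unique (tendsto_ultraDensity _) ?_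
      simp [density])
    (by
      rintro _ _ ⟨S, rfl⟩ ⟨T, rfl⟩ hd
      have h1 : ∃ S', internal S' = internal S := ⟨S, rfl⟩
      have h2 : ∃ T', internal T' = internal T := ⟨T, rfl⟩
      have h3 : ∃ R, internal R = internal S ∪ internal T := ⟨_, internal_union S T⟩
      rw [dif_pos h1, dif_pos h2, dif_pos h3, ultraDensity_congr h1.choose_spec,
        ultraDensity_congr h2.choose_spec,
        ultraDensity_congr (h3.choose_spec.trans (internal_union S T).symm)]
      refine tendsto_nhds_unique (tendsto_ultraDensity _)
        (((tendsto_ultraDensity S).add (tendsto_ultraDensity T)).congr' ?_)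
      rw [disjoint_iff_inter_eq_empty, ← internal_inter, internal_eq_empty_iff] at hd
      filter_upwards [hd] with n hn
      rw [density, density, density, ncard_union_eq (disjoint_iff_inter_eq_empty.2 hn),
        Nat.cast_add, ENNReal.add_div])

lemma internalContent_internal (S : ∀ n, Set (Y n)) :
    internalContent Y (internal S) = ultraDensity S := by
  have h : ∃ S', internal S' = internal S := ⟨S, rfl⟩
  change (if h : ∃ S', internal S' = internal S then ultraDensity h.choose else 0) = _
  rw [dif_pos h, ultraDensity_congr h.choose_spec]

lemma isSigmaSubadditive_internalContent : (internalContent Y).IsSigmaSubadditive := by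
  intro F hF hU
  choose S hS using hF
  obtain ⟨T, hT⟩ := hU
  obtain ⟨N, hN⟩ := exists_internal_subset_biUnion (T := T) (S := S) (by simp only [hS, hT, subset_rfl])
  have hring := (isSetAlgebra_range_internal (Y := Y)).isSetRing
  simp only [hS] at hN
  rw [hT] at hN
  have hmem : ∀ k ∈ Finset.range N, F k ∈ range (internal (Y := Y)) := fun k _ => ⟨_, hS k⟩
  calc internalContent Y (⋃ i, F i) ≤ internalContent Y (⋃ k ∈ Finset.range N, F k) :=
        addContent_mono hring.isSetSemiring ⟨T, hT⟩ (hring.biUnion_mem _ hmem) hN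
    _ ≤ ∑ k ∈ Finset.range N, internalContent Y (F k) := addContent_biUnion_le hring hmem
    _ ≤ ∑' k, internalContent Y (F k) := ENNReal.sum_le_tsum _

/-- The Loeb measure on the ultraproduct of a sequence of finite types. -/
noncomputable def loeb (Y : ℕ → Type*) [∀ n, Nonempty (Y n)] [∀ n, Fintype (Y n)] :
    Measure (UProd Y) :=
  (internalContent Y).measure isSetAlgebra_range_internal.isSetRing.isSetSemiring le_rfl
    isSigmaSubadditive_internalContent

lemma tendsto_loeb (S : ∀ n, Set (Y n)) :
    Tendsto (fun n => density (S n)) (hyperfilter ℕ : Filter ℕ) (𝓝 (loeb Y (internal S))) := by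
  have hS : internal S ∈ range (internal (Y := Y)) := ⟨S, rfl⟩
  rw [loeb, AddContent.measure_eq _ _ rfl _ hS, internalContent_internal]
  exact tendsto_ultraDensity S

instance : IsProbabilityMeasure (loeb Y) := by
  have huniv : (univ : Set (UProd Y)) = internal fun n => univ := by ext; simp [mem_internal]
  refine ⟨huniv ▸ tendsto_nhds_unique (tendsto_loeb fun n => (univ : Set (Y n)))
    (tendsto_const_nhds.congr fun n => ?_)⟩
  rw [density, ncard_univ]
  exact (ENNReal.div_self (by simp) (by simp)).symm

lemma tendsto_loeb_real (S : ∀ n, Set (Y n)) :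
    Tendsto (fun n => ((S n).ncard : ℝ) / Fintype.card (Y n)) (hyperfilter ℕ : Filter ℕ)
      (𝓝 ((loeb Y).real (internal S))) := by
  refine ((ENNReal.tendsto_toReal (measure_ne_top _ _)).comp (tendsto_loeb S)).congr fun n => ?_
  simp [density]

end Loeb

section Resampling

variable {ι : Type*}

lemma piecewise_piecewise_piecewise {V : Type*} (f : Finset ι) (x y : ι → V) :
    f.piecewise (f.piecewise x y) (f.piecewise y x) = x := by
  ext i
  by_cases hi : i ∈ f <;> simp [hi]

/-- Exchanging the coordinates outside `f` in a pair of points. -/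
noncomputable def swapOff {V : Type*} (f : Finset ι) : (ι → V) × (ι → V) ≃ (ι → V) × (ι → V) where
  toFun p := (f.piecewise p.1 p.2, f.piecewise p.2 p.1)
  invFun p := (f.piecewise p.1 p.2, f.piecewise p.2 p.1)
  left_inv p := by simp only [piecewise_piecewise_piecewise]
  right_inv p := by simp only [piecewise_piecewise_piecewise]

lemma exists_abs_sum_indicator_le [Fintype ι] {V : Type*} [Fintype V] [Nonempty V] {f : Finset ι}
    {H : (ι → V) → ℝ} (hH : DependsOn H f) (S : Set (ι → V)) :
    ∃ y, |∑ x, S.indicator H x| ≤ |∑ x, {x | f.piecewise x y ∈ S}.indicator H x| := by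
  by_contra! hc
  have hsum : ∑ y, ∑ x, {x | f.piecewise x y ∈ S}.indicator H x =
      Fintype.card (ι → V) * ∑ x, S.indicator H x := by
    calc ∑ y, ∑ x, {x | f.piecewise x y ∈ S}.indicator H x
        = ∑ x, ∑ y, S.indicator H (f.piecewise x y) := by
          rw [Finset.sum_comm]
          refine Finset.sum_congr rfl fun x _ => Finset.sum_congr rfl fun y _ => ?_
          have : H (f.piecewise x y) = H x := hH fun i hi => by
            rw [Finset.piecewise_eq_of_mem _ _ _ (Finset.mem_coe.1 hi)]
          by_cases h : f.piecewise x y ∈ S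
          · rw [indicator_of_mem h, indicator_of_mem (show x ∈ {x | f.piecewise x y ∈ S} from h),
              this]
          · rw [indicator_of_notMem h,
              indicator_of_notMem (show x ∉ {x | f.piecewise x y ∈ S} from h)]
      _ = ∑ p : (ι → V) × (ι → V), S.indicator H (swapOff f p).1 :=
          (Fintype.sum_prod_type fun p : (ι → V) × (ι → V) => S.indicator H (swapOff f p).1).symm
      _ = ∑ p : (ι → V) × (ι → V), S.indicator H p.1 :=
          Equiv.sum_comp (swapOff f) fun p => S.indicator H p.1
      _ = _ := by
          rw [Fintype.sum_prod_type_right]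
          simp
  have hlt := (Finset.abs_sum_le_sum_abs _ _).trans_lt
    (Finset.sum_lt_sum_of_nonempty Finset.univ_nonempty fun y (_ : y ∈ Finset.univ) => hc y)
  rw [hsum, abs_mul, Nat.abs_cast] at hlt
  simp at hlt

variable {V : ℕ → Type*}

/-- The internal sets depending only on the coordinates in `J`. -/
def coordAlgebra (V : ℕ → Type*) (J : Finset ι) : Set (Set (UProd fun n => ι → V n)) :=
  {T | ∃ S : ∀ n, Set (ι → V n), (∀ n, DependsOn (· ∈ S n) J) ∧ internal S = T}

lemma isSetAlgebra_coordAlgebra (J : Finset ι) : IsSetAlgebra (coordAlgebra V J) where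
  empty_mem := ⟨_, fun _ _ _ _ => rfl, internal_empty⟩
  compl_mem := by
    rintro _ ⟨S, hS, rfl⟩
    exact ⟨_, fun n x y h => congrArg Not (hS n h), internal_compl S⟩
  union_mem := by
    rintro _ _ ⟨S, hS, rfl⟩ ⟨T, hT, rfl⟩
    exact ⟨_, fun n x y h => congrArg₂ Or (hS n h) (hT n h), internal_union S T⟩

lemma coordAlgebra_mono {J J' : Finset ι} (h : J ⊆ J') :
    coordAlgebra V J ⊆ coordAlgebra V J' := by
  rintro _ ⟨S, hS, rfl⟩
  exact ⟨S, fun n => (hS n).mono (Finset.coe_subset.2 h), rfl⟩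

lemma measurableSet_of_mem_coordAlgebra {J : Finset ι} {T : Set (UProd fun n => ι → V n)}
    (hT : T ∈ coordAlgebra V J) : MeasurableSet T := by
  obtain ⟨S, -, rfl⟩ := hT
  exact measurableSet_internal S

/-- The resampling map, replacing the coordinates outside `f` by those of `y`. -/
noncomputable def resample (f : Finset ι) (y x : UProd fun n => ι → V n) : UProd fun n => ι → V n :=
  fun n => f.piecewise (x n) (y n)

lemma preimage_resample_mem_coordAlgebra (f : Finset ι) (y : UProd fun n => ι → V n)
    {J : Finset ι} {T : Set (UProd fun n => ι → V n)} (hT : T ∈ coordAlgebra V J) :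
    resample f y ⁻¹' T ∈ coordAlgebra V (J ∩ f) := by
  obtain ⟨S, hS, rfl⟩ := hT
  refine ⟨fun n => {x | f.piecewise x (y n) ∈ S n}, fun n x x' h => hS n fun i hi => ?_, rfl⟩
  by_cases hif : i ∈ f
  · simpa [hif] using h i (Finset.mem_coe.2 (Finset.mem_inter.2 ⟨Finset.mem_coe.1 hi, hif⟩))
  · simp [hif]

variable [Fintype ι] [∀ n, Fintype (V n)] [∀ n, Nonempty (V n)]

/-- A function is approximately internal with support in the coordinates `f` if its integrals over
internal sets are ultralimits of averages of functions depending on those coordinates. -/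
def IsInternalOn (f : Finset ι) (u : (UProd fun n => ι → V n) → ℝ) : Prop :=
  Integrable u (loeb fun n => ι → V n) ∧ ∃ H : ∀ n, (ι → V n) → ℝ, (∀ n, DependsOn (H n) f) ∧
    ∀ S : ∀ n, Set (ι → V n), Tendsto
      (fun n => (∑ x, (S n).indicator (H n) x) / Fintype.card (ι → V n))
      (hyperfilter ℕ : Filter ℕ) (𝓝 (∫ x in internal S, u x ∂loeb fun n => ι → V n))

lemma IsInternalOn.add {f : Finset ι} {u v : (UProd fun n => ι → V n) → ℝ}
    (hu : IsInternalOn f u) (hv : IsInternalOn f v) : IsInternalOn f (u + v) := by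
  obtain ⟨hui, H, hH, hHu⟩ := hu
  obtain ⟨hvi, K, hK, hKv⟩ := hv
  refine ⟨hui.add hvi, fun n => H n + K n,
    fun n x y h => congrArg₂ (· + ·) (hH n h) (hK n h), fun S => ?_⟩
  have := (hHu S).add (hKv S)
  rw [← integral_add hui.integrableOn hvi.integrableOn] at this
  refine this.congr fun n => ?_
  rw [← add_div, ← Finset.sum_add_distrib, indicator_add']
  rfl

lemma isInternalOn_indicator {f : Finset ι} (c : ℝ) {G : Set (UProd fun n => ι → V n)}
    (hG : G ∈ coordAlgebra V f) : IsInternalOn f (G.indicator fun _ => c) := by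
  have hGm := measurableSet_of_mem_coordAlgebra hG
  obtain ⟨R, hR, rfl⟩ := hG
  refine ⟨(integrable_const c).indicator hGm, fun n => (R n).indicator fun _ => c,
    fun n x y h => ?_, fun S => ?_⟩
  · have := hR n h
    simp only [indicator_apply]
    congr 1
  · rw [integral_indicator hGm, Measure.restrict_restrict hGm, setIntegral_const, smul_eq_mul,
      ← internal_inter]
    refine ((tendsto_loeb_real _).mul_const c).congr fun n => ?_
    rw [div_mul_eq_mul_div]
    congr 1
    simp only [indicator_indicator]
    rw [Finset.sum_indicator_eq_sum_filter, Finset.sum_const, nsmul_eq_mul,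
      ncard_eq_toFinset_card']
    congr 3
    ext
    simp [and_comm]

lemma IsInternalOn.exists_abs_setIntegral_le {f : Finset ι} {u : (UProd fun n => ι → V n) → ℝ}
    (hu : IsInternalOn f u) (S : ∀ n, Set (ι → V n)) :
    ∃ y, |∫ x in internal S, u x ∂loeb fun n => ι → V n| ≤
      |∫ x in resample f y ⁻¹' internal S, u x ∂loeb fun n => ι → V n| := by
  obtain ⟨-, H, hH, hHu⟩ := hu
  choose y hy using fun n => exists_abs_sum_indicator_le (hH n) (S n)
  refine ⟨y, le_of_tendsto_of_tendsto' (hHu S).abs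
    (hHu fun n => {x | f.piecewise x (y n) ∈ S n}).abs fun n => ?_⟩
  rw [abs_div, abs_div]
  exact div_le_div_of_nonneg_right (hy n) (abs_nonneg _)

lemma abs_setIntegral_sub_le {X : Type*} [MeasurableSpace X] {μ : Measure X} {u v : X → ℝ}
    (hu : Integrable u μ) (hv : Integrable v μ) (T : Set X) :
    |∫ x in T, u x ∂μ - ∫ x in T, v x ∂μ| ≤ ∫ x, |u x - v x| ∂μ := by
  rw [← integral_sub hu.integrableOn hv.integrableOn]
  exact (abs_integral_le_integral_abs).trans
    (setIntegral_le_integral (hu.sub hv).abs (ae_of_all _ fun x => abs_nonneg _))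

/-- An integrable function measurable in the coordinates `f` has zero integral over an internal set
as soon as it has zero integral over all its resamplings. -/
lemma setIntegral_internal_eq_zero {f : Finset ι} {u : (UProd fun n => ι → V n) → ℝ}
    (hu : Integrable u (loeb fun n => ι → V n))
    (hum : StronglyMeasurable[MeasurableSpace.generateFrom (coordAlgebra V f)] u)
    {S : ∀ n, Set (ι → V n)}
    (hS : ∀ y, ∫ x in resample f y ⁻¹' internal S, u x ∂loeb (fun n => ι → V n) = 0) :
    ∫ x in internal S, u x ∂loeb (fun n => ι → V n) = 0 := by
  rw [← abs_nonpos_iff]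
  refine le_of_forall_pos_le_add fun ε hε => ?_
  obtain ⟨v, hv, hvi, hle⟩ := exists_integral_abs_sub_le_of_isSetAlgebra
    (isSetAlgebra_coordAlgebra f) rfl
    (MeasurableSpace.generateFrom_le fun _ => measurableSet_of_mem_coordAlgebra)
    (fun c G hG => isInternalOn_indicator c hG) (fun _ _ => IsInternalOn.add) hu hum (half_pos hε)
  obtain ⟨y, hy⟩ := hv.exists_abs_setIntegral_le S
  have h1 := abs_setIntegral_sub_le hu hvi (internal S)
  have h2 := abs_setIntegral_sub_le hu hvi (resample f y ⁻¹' internal S)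
  rw [hS y, zero_sub, abs_neg] at h2
  have h3 := abs_sub_abs_le_abs_sub (∫ x in internal S, u x ∂loeb (fun n => ι → V n))
    (∫ x in internal S, v x ∂loeb fun n => ι → V n)
  linarith

/-- The algebras of internal sets depending on given coordinates form a coordinate system. -/
lemma isCoordinateSystem_coordAlgebra :
    IsCoordinateSystem (loeb fun n => ι → V n) (coordAlgebra (ι := ι) V) where
  isSetAlgebra := isSetAlgebra_coordAlgebra
  mono _ _ := coordAlgebra_mono
  measurableSet _ _ := measurableSet_of_mem_coordAlgebra
  condExp_eq := by
    intro f I hIf hfI A hA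
    set μ := loeb fun n => ι → V n
    set g := μ[A.indicator (1 : UProd (fun n => ι → V n) → ℝ) |
      joinSigma (coordAlgebra V) {J | J ⊂ f}]
    have hA0 := measurableSet_of_mem_coordAlgebra hA
    have hmeas : ∀ I' : Set (Finset ι), joinSigma (coordAlgebra V) I' ≤
        instMeasurableSpaceUProd := by
      refine fun I' => MeasurableSpace.generateFrom_le ?_
      rintro _ ⟨J, -, hT⟩
      exact measurableSet_of_mem_coordAlgebra hT
    have hmM : joinSigma (coordAlgebra V) {J | J ⊂ f} ≤ joinSigma (coordAlgebra V) I := joinSigma_mono _ hfI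
    have hmf : joinSigma (coordAlgebra V) {J | J ⊂ f} ≤
        MeasurableSpace.generateFrom (coordAlgebra V f) :=
      MeasurableSpace.generateFrom_mono fun T ⟨J, hJ, hT⟩ => coordAlgebra_mono hJ.1 hT
    have hi : Integrable (A.indicator (1 : UProd (fun n => ι → V n) → ℝ)) μ := integrable_indicator_one hA0
    have hgi : Integrable g μ := integrable_condExp
    set Q : Set (Set (UProd fun n => ι → V n)) := {T | MeasurableSet[joinSigma (coordAlgebra V) I] T ∧
      (∃ S, internal S = T) ∧ ∀ y, MeasurableSet[joinSigma (coordAlgebra V) {J | J ⊂ f}] (resample f y ⁻¹' T)}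
    have hpi : IsPiSystem Q := by
      rintro _ ⟨hM1, ⟨S, rfl⟩, h1⟩ _ ⟨hM2, ⟨T, rfl⟩, h2⟩ -
      exact ⟨hM1.inter hM2, ⟨_, internal_inter S T⟩, fun y => (h1 y).inter (h2 y)⟩
    have hgen : joinSigma (coordAlgebra V) I = MeasurableSpace.generateFrom Q := by
      refine le_antisymm (MeasurableSpace.generateFrom_mono ?_)
        (MeasurableSpace.generateFrom_le fun T hT => hT.1)
      rintro T ⟨J, hJ, hT⟩
      refine ⟨measurableSet_joinSigma hJ hT, ?_, fun y => measurableSet_joinSigma (J := J ∩ f)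
        ⟨Finset.inter_subset_right, fun h => hIf J hJ (h.trans Finset.inter_subset_left)⟩
        (preimage_resample_mem_coordAlgebra f y hT)⟩
      obtain ⟨S, -, hS⟩ := hT
      exact ⟨S, hS⟩
    have hint : ∀ T, MeasurableSet[joinSigma (coordAlgebra V) {J | J ⊂ f}] T →
        ∫ x in T, g x ∂μ = ∫ x in T, A.indicator (1 : UProd (fun n => ι → V n) → ℝ) x ∂μ := fun T hT =>
      setIntegral_condExp (hmeas _) hi hT
    have hset : ∀ T, MeasurableSet[joinSigma (coordAlgebra V) I] T →
        ∫ x in T, g x ∂μ = ∫ x in T, A.indicator (1 : UProd (fun n => ι → V n) → ℝ) x ∂μ := by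
      intro T hT
      induction T, hT using MeasurableSpace.induction_on_inter hgen hpi with
      | empty => simp
      | basic T hT =>
        obtain ⟨-, ⟨S, rfl⟩, hres⟩ := hT
        have := setIntegral_internal_eq_zero (u := A.indicator (1 : UProd (fun n => ι → V n) → ℝ) - g) (f := f) (S := S)
          (hi.sub hgi) ((stronglyMeasurable_one.indicator
            (MeasurableSpace.measurableSet_generateFrom hA)).sub
            (stronglyMeasurable_condExp.mono hmf)) (fun y => by
              have := hint _ (hres y)
              simp only [Pi.sub_apply]
              rw [integral_sub hi.integrableOn hgi.integrableOn, this, sub_self])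
        simp only [Pi.sub_apply] at this
        rw [integral_sub hi.integrableOn hgi.integrableOn] at this
        linarith
      | compl T hT ih =>
        have hT0 := hmeas _ _ hT
        have h1 := integral_add_compl hT0 hgi
        have h2 := integral_add_compl hT0 hi
        have h3 := hint univ MeasurableSet.univ
        simp only [setIntegral_univ] at h3
        linarith
      | iUnion T hd hT ih =>
        rw [integral_iUnion (fun i => hmeas _ _ (hT i)) hd hgi.integrableOn,
          integral_iUnion (fun i => hmeas _ _ (hT i)) hd hi.integrableOn]
        exact tsum_congr ih
    exact (ae_eq_condExp_of_forall_setIntegral_eq (hmeas I) hi (fun T _ _ => hgi.integrableOn)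
      (fun T hT _ => hset T hT)
      (stronglyMeasurable_condExp.mono hmM).aestronglyMeasurable).symm

end Resampling

section Removal

lemma ncard_image_mul_pow_le {VK V : Type*} [Fintype VK] [Fintype V] {e : Finset VK}
    {F : Set (VK → V)} (hF : DependsOn (· ∈ F) e) :
    ((fun π : VK → V => e.image π) '' F).ncard * Fintype.card V ^ (Fintype.card VK - e.card) ≤
      F.ncard := by
  set B := (fun π : VK → V => e.image π) '' F
  have hB' : ∀ b : B, ∃ π ∈ F, e.image π = b := fun b => b.2
  choose π hπF hπ using hB'
  set φ : B × ({i // i ∉ e} → V) → VK → V := fun p i =>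
    if hi : i ∈ e then π p.1 i else p.2 ⟨i, hi⟩ with hφ
  have hφe : ∀ p, ∀ i ∈ e, φ p i = π p.1 i := fun p i hi => by simp [hφ, hi]
  have hφF : ∀ p, φ p ∈ F := fun p => by
    have := hF (x := φ p) (y := π p.1) fun i hi => hφe p i (Finset.mem_coe.1 hi)
    exact this.mpr (hπF p.1)
  have hinj : Function.Injective fun p => (⟨φ p, hφF p⟩ : F) := by
    rintro ⟨b, ρ⟩ ⟨b', ρ'⟩ h
    have h' : φ (b, ρ) = φ (b', ρ') := congrArg Subtype.val h
    have hb : ∀ p, e.image (φ p) = p.1 := fun p => by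
      rw [← hπ p.1]
      exact Finset.image_congr fun i hi => hφe p i (Finset.mem_coe.1 hi)
    have h1 : b = b' := Subtype.ext (by rw [← hb (b, ρ), ← hb (b', ρ'), h'])
    have h2 : ρ = ρ' := by
      ext i
      have := congrFun h' i
      simpa [hφ, i.2] using this
    rw [h1, h2]
  have hcard := Nat.card_le_card_of_injective _ hinj
  rw [Nat.card_prod, Nat.card_coe_set_eq, Nat.card_coe_set_eq, Nat.card_fun,
    Nat.card_eq_fintype_card, Nat.card_eq_fintype_card, Fintype.card_subtype_compl,
    Fintype.card_coe] at hcard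
  exact hcard

lemma pow_le_mul_choose {n k : ℕ} (hk : 1 ≤ k) (hkn : k ≤ n) :
    (n : ℝ) ^ k ≤ (k ^ k * k.factorial : ℕ) * (n.choose k : ℝ) := by
  have h1 : ((n + 1 - k : ℕ) ^ k : ℝ) / k.factorial ≤ n.choose k := Nat.pow_le_choose k n
  rw [div_le_iff₀ (by positivity)] at h1
  have h2 : n ≤ k * (n + 1 - k) := by
    obtain ⟨d, rfl⟩ := Nat.exists_eq_add_of_le hkn
    rw [show k + d + 1 - k = d + 1 by lia]
    nlinarith
  calc (n : ℝ) ^ k ≤ (k * (n + 1 - k : ℕ) : ℝ) ^ k := by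
        gcongr
        exact_mod_cast h2
    _ = k ^ k * ((n + 1 - k : ℕ) : ℝ) ^ k := mul_pow _ _ _
    _ ≤ k ^ k * (n.choose k * k.factorial) := by gcongr
    _ = _ := by push_cast; ring

lemma dependsOn_image_mem {VK V : Type*} (e : Finset VK) (A : Set (Finset V)) :
    DependsOn (fun π : VK → V => π ∈ {π : VK → V | e.image π ∈ A}) e := by
  intro x y h
  have : e.image x = e.image y := Finset.image_congr fun i hi => h i hi
  simp only [mem_ofPred_eq, this]

/-- If the sets of maps sending each edge of `K` to an edge of `A` can be shrunk slightly, in a way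
depending only on the edge, so as to have empty intersection, then few edges of `A` need to be
removed to destroy all homomorphisms from `K`. -/
lemma exists_removal_of_shrinking {k : ℕ} (hk : 1 ≤ k) {VK V : Type*} [Fintype VK] [Fintype V]
    [Nonempty V] {K : Finset (Finset VK)} (hK : ∀ e ∈ K, e.card = k) {A : Set (Finset V)}
    (hA : ∀ b ∈ A, b.card = k) {R : K → Set (VK → V)} (hR : ∀ e, DependsOn (· ∈ R e) e.1)
    (hR0 : ⋂ e, R e = ∅) {η : ℝ}
    (hη : ∀ e : K, (({π : VK → V | e.1.image π ∈ A} \ R e).ncard : ℝ) / Fintype.card (VK → V) ≤ η) :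
    ∃ C ⊆ A, (C.ncard : ℝ) ≤
        K.card * η * (k ^ k * k.factorial : ℕ) * ((Fintype.card V).choose k : ℝ) ∧
      ∀ π : VK → V, ¬ ∀ e ∈ K, e.image π ∈ A \ C := by
  set B : K → Set (Finset V) := fun e =>
    (fun π : VK → V => e.1.image π) '' ({π : VK → V | e.1.image π ∈ A} \ R e)
  have hBA : ⋃ e, B e ⊆ A := by
    refine iUnion_subset fun e => ?_
    rintro _ ⟨π, hπ, rfl⟩
    exact hπ.1
  refine ⟨⋃ e, B e, hBA, ?_, fun π hπ => ?_⟩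
  · by_cases hkV : k ≤ Fintype.card V
    · have hBe : ∀ e, ((B e).ncard : ℝ) ≤ η * Fintype.card V ^ k := by
        intro e
        have hle : k ≤ Fintype.card VK := by
          rw [← hK e.1 e.2]
          exact Finset.card_le_univ _
        have h1 : ((B e).ncard : ℝ) * Fintype.card V ^ (Fintype.card VK - k) ≤
            (({π : VK → V | e.1.image π ∈ A} \ R e).ncard : ℝ) := by
          have := ncard_image_mul_pow_le
            (F := {π : VK → V | e.1.image π ∈ A} \ R e) (e := e.1) fun x y h =>
              congrArg₂ (fun p q : Prop => p ∧ ¬ q) (dependsOn_image_mem e.1 A h) (hR e h)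
          rw [hK e.1 e.2] at this
          exact_mod_cast this
        have h2 := hη e
        have hV : (0 : ℝ) < Fintype.card V := by exact_mod_cast Fintype.card_pos
        rw [Fintype.card_fun, Nat.cast_pow, div_le_iff₀ (by positivity)] at h2
        refine le_of_mul_le_mul_right (h1.trans (h2.trans_eq ?_))
          (pow_pos hV (Fintype.card VK - k))
        rw [mul_assoc, ← pow_add, Nat.add_sub_cancel' hle]
      have hη0 : (K.card : ℝ) * η = 0 ∨ 0 ≤ η := by
        rcases K.eq_empty_or_nonempty with rfl | ⟨e, he⟩
        · simp
        · exact Or.inr (le_trans (by positivity) (hη ⟨e, he⟩))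
      calc ((⋃ e, B e).ncard : ℝ) ≤ ∑ e, ((B e).ncard : ℝ) := by
            exact_mod_cast ncard_iUnion_le_of_fintype B
        _ ≤ ∑ _e : K, η * (Fintype.card V : ℝ) ^ k := Finset.sum_le_sum fun e _ => hBe e
        _ = K.card * η * (Fintype.card V : ℝ) ^ k := by
            rw [Finset.sum_const, Finset.card_univ, Fintype.card_coe, nsmul_eq_mul, mul_assoc]
        _ ≤ K.card * η * ((k ^ k * k.factorial : ℕ) * ((Fintype.card V).choose k : ℝ)) := by
            refine mul_le_mul_of_nonneg_left (pow_le_mul_choose hk hkV) ?_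
            rcases hη0 with h | h
            · exact h.ge
            · positivity
        _ = _ := by ring
    · have hemp : ⋃ e, B e = ∅ := by
        refine eq_empty_of_forall_notMem fun b hb => hkV ?_
        rw [← hA b (hBA hb)]
        exact Finset.card_le_univ _
      rw [hemp, ncard_empty, Nat.choose_eq_zero_of_lt (not_le.1 hkV)]
      simp
  · have hmem : π ∈ ⋂ e, R e := by
      refine mem_iInter.2 fun e => ?_
      by_contra hc
      exact (hπ e.1 e.2).2 (mem_iUnion.2 ⟨e, π, ⟨(hπ e.1 e.2).1, hc⟩, rfl⟩)
    rw [hR0] at hmem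
    exact hmem

lemma exists_removal {k : ℕ} (hk : 1 ≤ k) {VK : Type} [Fintype VK] {K : Finset (Finset VK)}
    (hK0 : K.Nonempty) (hK : ∀ e ∈ K, e.card = k) {ε : ℝ} (hε : 0 < ε) :
    ∃ δ : ℝ, 0 < δ ∧ ∀ (V : Type) (_ : Fintype V) (_ : Nonempty V) (A : Set (Finset V)),
      (∀ b ∈ A, b.card = k) →
      ({π : VK → V | ∀ e ∈ K, e.image π ∈ A}.ncard : ℝ) <
        δ * (Fintype.card V : ℝ) ^ Fintype.card VK →
      ∃ C ⊆ A, (C.ncard : ℝ) ≤ ε * ((Fintype.card V).choose k : ℝ) ∧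
        ∀ π : VK → V, ¬ ∀ e ∈ K, e.image π ∈ A \ C := by
  by_contra! hcon
  choose V hfin hne A hA hlt hbad using fun n : ℕ => hcon (1 / ((n : ℝ) + 1)) (by positivity)
  set μ := loeb fun n => VK → V n
  set S : K → ∀ n, Set (VK → V n) := fun e n => {π | e.1.image π ∈ A n} with hS
  have hS0 : μ (⋂ e, internal (S e)) = 0 := by
    rw [← internal_iInter, ← measureReal_eq_zero_iff]
    refine tendsto_nhds_unique (tendsto_loeb_real _) ?_
    have h0 : Tendsto (fun n : ℕ => 1 / ((n : ℝ) + 1)) (hyperfilter ℕ : Filter ℕ) (𝓝 0) :=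
      tendsto_one_div_add_atTop_nhds_zero_nat.mono_left Nat.hyperfilter_le_atTop
    refine squeeze_zero (fun n => by positivity) (fun n => ?_) h0
    have hset : ⋂ e, S e n = {π : VK → V n | ∀ e ∈ K, e.image π ∈ A n} := by
      ext π
      simp [hS]
    have hV : (0 : ℝ) < Fintype.card (V n) := by exact_mod_cast Fintype.card_pos
    rw [hset, Fintype.card_fun, Nat.cast_pow, div_le_iff₀ (by positivity)]
    exact (hlt n).le
  have hKc : (0 : ℝ) < K.card := by exact_mod_cast hK0.card_pos
  have hkc : (0 : ℝ) < (k ^ k * k.factorial : ℕ) := by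
    exact_mod_cast Nat.mul_pos (pow_pos hk k) k.factorial_pos
  obtain ⟨F, hF, hFlt, hFemp⟩ := isCoordinateSystem_coordAlgebra.exists_iInter_eq_empty
    (fun e : K => e.1) (fun e => internal (S e))
    (fun e => ⟨S e, fun n => dependsOn_image_mem e.1 (A n), rfl⟩) hS0
    (ε := ε / (K.card * (k ^ k * k.factorial : ℕ))) (by positivity)
  choose R hR hRF using hF
  have hev : ∀ e : K, ∀ᶠ n in (hyperfilter ℕ : Filter ℕ),
      ((S e n \ R e n).ncard : ℝ) / Fintype.card (VK → V n) <
        ε / (K.card * (k ^ k * k.factorial : ℕ)) := by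
    intro e
    have := hFlt e
    rw [← hRF e, ← internal_sdiff] at this
    exact (tendsto_loeb_real _).eventually_lt_const this
  simp only [← hRF] at hFemp
  rw [← internal_iInter, internal_eq_empty_iff] at hFemp
  obtain ⟨n, hn0, hn⟩ := (hFemp.and (eventually_all.2 hev)).exists
  obtain ⟨C, hCA, hC, hC0⟩ := exists_removal_of_shrinking hk hK (hA n) (fun e => hR e n) hn0
    (fun e => (hn e).le)
  obtain ⟨π, hπ⟩ := hbad n C hCA (hC.trans_eq (by field_simp))
  exact hC0 π hπ

end Removal

end HypergraphRemoval

/-- **Hypergraph removal lemma (dense case).** For every `k ≥ 1`, every `k`-uniform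
hypergraph `K` on a finite vertex set `VK`, and every `ε > 0`, there is a `δ > 0` such that
whenever `A` is a `k`-uniform hypergraph on a finite vertex set `VA` with
`hom(K,A) < δ·|VA|^{|VK|}`, there is `C ⊆ A` with `|C| ≤ ε·choose(|VA|,k)` and
`hom(K, A \ C) = 0`. -/
theorem hypergraph_removal :
    ∀ k : ℕ, 1 ≤ k →
    ∀ (VK : Type) [Fintype VK] (K : Finset (Finset VK)), (∀ e ∈ K, e.card = k) →
    ∀ ε : ℝ, 0 < ε →
    ∃ δ : ℝ, 0 < δ ∧
      ∀ (VA : Type) [Fintype VA] [DecidableEq VA] (A : Finset (Finset VA)),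
        (∀ e ∈ A, e.card = k) →
        (((Finset.univ : Finset (VK → VA)).filter
            (fun π => ∀ e ∈ K, e.image π ∈ A)).card : ℝ)
          < δ * (Fintype.card VA : ℝ) ^ (Fintype.card VK) →
        ∃ C ⊆ A, (C.card : ℝ) ≤ ε * ((Fintype.card VA).choose k : ℝ) ∧
          ((Finset.univ : Finset (VK → VA)).filter
            (fun π => ∀ e ∈ K, e.image π ∈ A \ C)).card = 0 := by
  intro k hk VK _ K hK ε hε
  rcases K.eq_empty_or_nonempty with rfl | hK0
  · refine ⟨1, one_pos, fun VA _ _ A _ hlt => ?_⟩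
    simp at hlt
  obtain ⟨δ, hδ, hrem⟩ := HypergraphRemoval.exists_removal hk hK0 hK hε
  refine ⟨δ, hδ, fun VA _ inst A hA hlt => ?_⟩
  obtain rfl : inst = fun a b => Classical.propDecidable (a = b) := Subsingleton.elim _ _
  have hne : Nonempty VA := by
    by_contra hemp
    rw [not_nonempty_iff] at hemp
    obtain ⟨e, he⟩ := hK0
    have hVK : Fintype.card VK ≠ 0 := by
      have := Finset.card_le_univ e
      rw [hK e he] at this
      lia
    rw [Fintype.card_eq_zero, Nat.cast_zero, zero_pow hVK, mul_zero] at hlt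
    exact absurd hlt (not_lt.2 (Nat.cast_nonneg _))
  obtain ⟨C, hCA, hC, hC0⟩ := hrem VA inferInstance hne A (fun b hb => hA b hb) (by
    convert hlt
    rw [Set.ncard_eq_toFinset_card']
    congr 1
    ext
    simp)
  have hfin := A.finite_toSet.subset hCA
  refine ⟨hfin.toFinset, fun b hb => hCA (hfin.mem_toFinset.1 hb), ?_, ?_⟩
  · rwa [← Set.ncard_eq_toFinset_card C hfin]
  · rw [Finset.card_eq_zero, Finset.filter_eq_empty_iff]
    intro π _ hπ
    refine hC0 π fun e he => ?_
    have := Finset.mem_sdiff.1 (hπ e he)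
    exact ⟨this.1, fun hc => this.2 (hfin.mem_toFinset.2 hc)⟩
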